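/- Let c ≤ b ≤ a and let M ∈ GL(b,2) with |ε(M)| = c. Then the sizes of the permutation orbits of M and of its embedding satisfy |S_a · φ_{b,a}(M)| · C(b,c) = |S_b · M| · C(a,c), where C(x,y) denotes the binomial coefficient; equivalently |S_a · φ_{b,a}(M)| = |S_b · M| · C(b,c)⁻¹ · C(a,c). -/

import Mathlib

/-- The embedding of a `b × b` matrix over `𝔽₂` into the upper-left corner of an
`a × a` matrix, with the identity in the lower-right block and zeros elsewhere. -/
def embedMat (b a : ℕ) (M : Matrix (Fin b) (Fin b) (ZMod 2)) :
    Matrix (Fin a) (Fin a) (ZMod 2) :=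
  fun i j =>
    if hi : (i : ℕ) < b then
      if hj : (j : ℕ) < b then M ⟨i, hi⟩ ⟨j, hj⟩ else 0
    else if i = j then 1 else 0

/-- The set of essential indices of a matrix: `i` is essential if some off-diagonal
entry in row `i` or column `i` equals `1`. -/
def essential {k : ℕ} (M : Matrix (Fin k) (Fin k) (ZMod 2)) : Set (Fin k) :=
  {i | ∃ j, j ≠ i ∧ (M i j = 1 ∨ M j i = 1)}

/-- The orbit of a matrix under the simultaneous row-and-column permutation action
of the symmetric group. -/
def permOrbit {k : ℕ} (M : Matrix (Fin k) (Fin k) (ZMod 2)) :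
    Set (Matrix (Fin k) (Fin k) (ZMod 2)) :=
  {N | ∃ σ : Equiv.Perm (Fin k), N = M.submatrix ⇑σ⁻¹ ⇑σ⁻¹}

theorem mem_permOrbit_iff {k : ℕ} {M N : Matrix (Fin k) (Fin k) (ZMod 2)} :
    N ∈ permOrbit M ↔ ∃ ρ : Equiv.Perm (Fin k), N = M.submatrix ρ ρ :=
  ⟨fun ⟨σ, h⟩ => ⟨σ⁻¹, h⟩, fun ⟨ρ, h⟩ => ⟨ρ⁻¹, by simpa using h⟩⟩

theorem submatrix_mem_permOrbit {k : ℕ} {M N : Matrix (Fin k) (Fin k) (ZMod 2)}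
    (h : N ∈ permOrbit M) (ρ : Equiv.Perm (Fin k)) : N.submatrix ρ ρ ∈ permOrbit M := by
  obtain ⟨τ, rfl⟩ := mem_permOrbit_iff.1 h
  exact mem_permOrbit_iff.2 ⟨ρ.trans τ, rfl⟩

theorem essential_submatrix {k : ℕ} (M : Matrix (Fin k) (Fin k) (ZMod 2))
    (ρ : Equiv.Perm (Fin k)) : essential (M.submatrix ρ ρ) = ρ ⁻¹' essential M := by
  ext i
  constructor
  · rintro ⟨j, hj, h⟩
    exact ⟨ρ j, fun e => hj (ρ.injective e), h⟩
  · rintro ⟨j, hj, h⟩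
    refine ⟨ρ.symm j, fun e => hj (by rw [← e, ρ.apply_symm_apply]), ?_⟩
    simpa using h

theorem apply_eq_zero_of_notMem_essential {k : ℕ} {M : Matrix (Fin k) (Fin k) (ZMod 2)}
    {i j : Fin k} (hij : i ≠ j) (h : ¬(i ∈ essential M ∧ j ∈ essential M)) : M i j = 0 := by
  have zero_of_ne_one : ∀ x : ZMod 2, x ≠ 1 → x = 0 := by decide
  refine zero_of_ne_one _ fun h1 => h ⟨⟨j, hij.symm, Or.inl h1⟩, ⟨i, hij, Or.inr h1⟩⟩

/-- Diagonal entries at inessential indices are `1`. -/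
def UnitOffEssential {k : ℕ} (M : Matrix (Fin k) (Fin k) (ZMod 2)) : Prop :=
  ∀ i ∉ essential M, M i i = 1

theorem unitOffEssential_coe {k : ℕ} (M : GL (Fin k) (ZMod 2)) :
    UnitOffEssential (M : Matrix (Fin k) (Fin k) (ZMod 2)) := by
  intro i hi
  have one_of_ne_zero : ∀ x : ZMod 2, x ≠ 0 → x = 1 := by decide
  refine one_of_ne_zero _ fun h0 => ?_
  have hdet : (M : Matrix (Fin k) (Fin k) (ZMod 2)).det = 0 := by
    refine Matrix.det_eq_zero_of_row_eq_zero i fun j => ?_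
    by_cases hij : i = j
    · rwa [← hij]
    · exact apply_eq_zero_of_notMem_essential hij fun h => hi h.1
  exact ((Matrix.isUnit_iff_isUnit_det _).1 M.isUnit).ne_zero hdet

theorem UnitOffEssential.submatrix {k : ℕ} {M : Matrix (Fin k) (Fin k) (ZMod 2)}
    (hM : UnitOffEssential M) (ρ : Equiv.Perm (Fin k)) :
    UnitOffEssential (M.submatrix ρ ρ) := by
  intro i hi
  rw [essential_submatrix] at hi
  exact hM (ρ i) hi

theorem UnitOffEssential.ext {k : ℕ} {M N : Matrix (Fin k) (Fin k) (ZMod 2)}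
    (hM : UnitOffEssential M) (hN : UnitOffEssential N) (hMN : essential M = essential N)
    (h : ∀ i ∈ essential M, ∀ j ∈ essential M, M i j = N i j) : M = N := by
  ext i j
  by_cases hij : i ∈ essential M ∧ j ∈ essential M
  · exact h i hij.1 j hij.2
  by_cases e : i = j
  · subst e
    have hi : i ∉ essential M := fun hi => hij ⟨hi, hi⟩
    rw [hM i hi, hN i (hMN ▸ hi)]
  · rw [apply_eq_zero_of_notMem_essential e hij,
      apply_eq_zero_of_notMem_essential (M := N) e (hMN ▸ hij)]

theorem embedMat_castLE {b a : ℕ} (hba : b ≤ a) (M : Matrix (Fin b) (Fin b) (ZMod 2))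
    (i j : Fin b) :
    embedMat b a M (Fin.castLE hba i) (Fin.castLE hba j) = M i j := by
  simp [embedMat]

theorem embedMat_apply_of_not_lt {b a : ℕ} (M : Matrix (Fin b) (Fin b) (ZMod 2)) {i j : Fin a}
    (h : ¬((i : ℕ) < b ∧ (j : ℕ) < b)) : embedMat b a M i j = if i = j then 1 else 0 := by
  unfold embedMat
  split_ifs with hi hj e <;> grind

theorem essential_embedMat {b a : ℕ} (hba : b ≤ a) (M : Matrix (Fin b) (Fin b) (ZMod 2)) :
    essential (embedMat b a M) = Fin.castLE hba '' essential M := by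
  ext i
  constructor
  · rintro ⟨j, hj, h⟩
    by_cases hlt : (i : ℕ) < b ∧ (j : ℕ) < b
    · refine ⟨⟨i, hlt.1⟩, ⟨⟨j, hlt.2⟩, fun e => hj (Fin.ext (by simpa using e)), ?_⟩, rfl⟩
      rwa [← embedMat_castLE hba M, ← embedMat_castLE hba M]
    · rw [embedMat_apply_of_not_lt M hlt, embedMat_apply_of_not_lt M (mt And.symm hlt),
        if_neg hj, if_neg hj.symm] at h
      simp at h
  · rintro ⟨i, ⟨j, hj, h⟩, rfl⟩
    refine ⟨Fin.castLE hba j, fun e => hj (Fin.castLE_injective hba e), ?_⟩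
    rwa [embedMat_castLE, embedMat_castLE]

theorem unitOffEssential_embedMat {b a : ℕ} (hba : b ≤ a)
    {M : Matrix (Fin b) (Fin b) (ZMod 2)} (hM : UnitOffEssential M) :
    UnitOffEssential (embedMat b a M) := by
  intro i hi
  by_cases h : (i : ℕ) < b
  · have e : i = Fin.castLE hba ⟨i, h⟩ := rfl
    rw [essential_embedMat hba] at hi
    rw [e, embedMat_castLE]
    exact hM _ fun hx => hi ⟨_, hx, rfl⟩
  · rw [embedMat_apply_of_not_lt M fun hx => h hx.1, if_pos rfl]

theorem embedMat_injective {b a : ℕ} (hba : b ≤ a) : Function.Injective (embedMat b a) := by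
  intro M N h
  ext i j
  rw [← embedMat_castLE hba M, h, embedMat_castLE]

theorem exists_perm_eqOn {k : ℕ} {s : Set (Fin k)} {f : Fin k → Fin k} (hf : Set.InjOn f s) :
    ∃ ρ : Equiv.Perm (Fin k), ∀ i ∈ s, ρ i = f i := by
  obtain ⟨g, hg⟩ := Set.MapsTo.exists_equiv_extend_of_card_eq (t := Finset.univ)
    (s := s) (f := f) (by simp) (by simp) hf
  exact ⟨g.trans (Equiv.subtypeUnivEquiv fun x => Finset.mem_univ x), hg⟩

theorem exists_perm_preimage_eq {k : ℕ} {s t : Set (Fin k)} (h : s.ncard = t.ncard) :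
    ∃ ρ : Equiv.Perm (Fin k), ρ ⁻¹' s = t := by
  classical
  have hcard : Nat.card t = Nat.card s := by
    rw [Nat.card_coe_set_eq, Nat.card_coe_set_eq, h]
  obtain ⟨e⟩ := Finite.card_eq.1 hcard
  refine ⟨e.extendSubtype, ?_⟩
  ext i
  by_cases hi : i ∈ t
  · simpa [hi] using e.extendSubtype_mem i hi
  · simpa [hi] using e.extendSubtype_not_mem i hi

/-- The members of the orbit of `M` with the same essential indices as `M`. -/
def essentialFiber {k : ℕ} (M : Matrix (Fin k) (Fin k) (ZMod 2)) :
    Set (Matrix (Fin k) (Fin k) (ZMod 2)) :=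
  {N ∈ permOrbit M | essential N = essential M}

theorem ncard_permOrbit {k : ℕ} (M : Matrix (Fin k) (Fin k) (ZMod 2)) :
    (permOrbit M).ncard = k.choose (essential M).ncard * (essentialFiber M).ncard := by
  classical
  rw [Set.ncard_eq_toFinset_card' (permOrbit M)]
  have hmaps : ∀ N ∈ (permOrbit M).toFinset,
      (essential N).toFinset ∈ (Finset.univ : Finset (Fin k)).powersetCard
        (essential M).ncard := by
    intro N hN
    obtain ⟨ρ, rfl⟩ := mem_permOrbit_iff.1 (Set.mem_toFinset.1 hN)
    rw [Finset.mem_powersetCard_univ, ← Set.ncard_eq_toFinset_card', essential_submatrix,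
      Set.ncard_preimage_of_injective_subset_range ρ.injective (by simp)]
  rw [Finset.card_eq_sum_card_fiberwise hmaps, Finset.sum_const_nat
    (m := (essentialFiber M).ncard), Finset.card_powersetCard, Finset.card_univ,
    Fintype.card_fin]
  intro S hS
  rw [Finset.mem_powersetCard_univ] at hS
  obtain ⟨ρ, hρ⟩ := exists_perm_preimage_eq (s := essential M) (t := (S : Set (Fin k)))
    (by simp [hS])
  rw [← Set.ncard_coe_finset]
  symm
  refine Set.ncard_congr (fun N _ => N.submatrix ρ ρ) ?_ ?_ ?_
  · rintro N ⟨hN, hE⟩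
    simp only [Finset.coe_filter, Set.mem_toFinset, Set.mem_ofPred_eq]
    refine ⟨submatrix_mem_permOrbit hN ρ, ?_⟩
    rw [← Finset.coe_inj, Set.coe_toFinset, essential_submatrix, hE, hρ]
  · intro N N' _ _ h
    simpa using congrArg (fun A => A.submatrix ρ.symm ρ.symm) h
  · intro N hN
    simp only [Finset.coe_filter, Set.mem_toFinset, Set.mem_ofPred_eq] at hN
    refine ⟨N.submatrix ρ.symm ρ.symm, ⟨submatrix_mem_permOrbit hN.1 _, ?_⟩, by simp⟩
    rw [essential_submatrix, ← Set.coe_toFinset (essential N), hN.2, ← hρ,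
      ← Set.preimage_comp]
    simp

theorem ncard_essentialFiber_embedMat {b a : ℕ} (hba : b ≤ a)
    {M : Matrix (Fin b) (Fin b) (ZMod 2)} (hM : UnitOffEssential M) :
    (essentialFiber (embedMat b a M)).ncard = (essentialFiber M).ncard := by
  have hinj := Fin.castLE_injective hba
  symm
  refine Set.ncard_congr (fun N _ => embedMat b a N) ?_
    (fun _ _ _ _ h => embedMat_injective hba h) ?_
  · rintro N ⟨hN, hE⟩
    refine ⟨?_, by rw [essential_embedMat hba, hE, essential_embedMat hba]⟩
    obtain ⟨ρ, rfl⟩ := mem_permOrbit_iff.1 hN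
    let ρ' := ρ.viaEmbedding (Fin.castLEEmb hba)
    have hρ' (x : Fin b) : ρ' (Fin.castLE hba x) = Fin.castLE hba (ρ x) :=
      ρ.viaEmbedding_apply (Fin.castLEEmb hba) x
    refine mem_permOrbit_iff.2 ⟨ρ', (unitOffEssential_embedMat hba (hM.submatrix ρ)).ext
      ((unitOffEssential_embedMat hba hM).submatrix ρ') ?_ ?_⟩
    · rw [essential_embedMat hba, essential_submatrix, essential_submatrix,
        essential_embedMat hba, ← Equiv.image_symm_eq_preimage, ← Equiv.image_symm_eq_preimage,
        Set.image_image, Set.image_image]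
      refine Set.image_congr fun x _ => ?_
      rw [Equiv.eq_symm_apply, hρ', Equiv.apply_symm_apply]
    · rw [essential_embedMat hba]
      rintro _ ⟨x, _, rfl⟩ _ ⟨y, _, rfl⟩
      simp only [Matrix.submatrix_apply, hρ', embedMat_castLE]
  · rintro N ⟨hN, hE⟩
    obtain ⟨ρ, rfl⟩ := mem_permOrbit_iff.1 hN
    have hpre := hE
    rw [essential_submatrix, essential_embedMat hba] at hpre
    have hmem : ∀ x ∈ essential M, ∃ y ∈ essential M,
        Fin.castLE hba y = ρ (Fin.castLE hba x) := fun x hx =>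
      hpre.ge ⟨x, hx, rfl⟩
    choose! f hfE hf using hmem
    have hfinj : Set.InjOn f (essential M) := by
      intro x hx y hy h
      refine hinj (ρ.injective ?_)
      rw [← hf x hx, ← hf y hy, h]
    obtain ⟨g, hg⟩ := exists_perm_eqOn hfinj
    have hgE : g ⁻¹' essential M = essential M := by
      symm
      refine Set.eq_of_subset_of_ncard_le (fun x hx => ?_) ?_
      · rw [Set.mem_preimage, hg x hx]
        exact hfE x hx
      · rw [Set.ncard_preimage_of_injective_subset_range g.injective (by simp)]
    have hgM : essential (M.submatrix g g) = essential M := by rw [essential_submatrix, hgE]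
    refine ⟨M.submatrix g g, ⟨mem_permOrbit_iff.2 ⟨g, rfl⟩, hgM⟩, ?_⟩
    refine (unitOffEssential_embedMat hba (hM.submatrix g)).ext
      ((unitOffEssential_embedMat hba hM).submatrix ρ) ?_ ?_
    · rw [hE, essential_embedMat hba, hgM, essential_embedMat hba]
    · rw [essential_embedMat hba, hgM]
      rintro _ ⟨x, hx, rfl⟩ _ ⟨y, hy, rfl⟩
      rw [embedMat_castLE, Matrix.submatrix_apply, Matrix.submatrix_apply, hg x hx, hg y hy,
        ← hf x hx, ← hf y hy, embedMat_castLE]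

theorem orbit_size_increase (c b a : ℕ) (hcb : c ≤ b) (hba : b ≤ a)
    (M : GL (Fin b) (ZMod 2))
    (hc : (essential (M : Matrix (Fin b) (Fin b) (ZMod 2))).ncard = c) :
    (permOrbit (embedMat b a (M : Matrix (Fin b) (Fin b) (ZMod 2)))).ncard
        * Nat.choose b c
      = (permOrbit (M : Matrix (Fin b) (Fin b) (ZMod 2))).ncard
        * Nat.choose a c := by
  have hcard : (essential (embedMat b a (M : Matrix (Fin b) (Fin b) (ZMod 2)))).ncard = c := by
    rw [essential_embedMat hba, Set.ncard_image_of_injective _ (Fin.castLE_injective hba), hc]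
  rw [ncard_permOrbit, ncard_permOrbit, hcard, hc,
    ncard_essentialFiber_embedMat hba (unitOffEssential_coe M)]
  ring
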